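/- arXiv:1210.3895 — 2 statements merged into one kernel-verified Lean document; each statement's English description precedes it below -/
import Mathlib

section
/- Let X be a connected metric space, let ε > 0 and N ∈ ℕ, and suppose that every finite family of pairwise disjoint open balls of radius ε in X has at most N members. Then diam(X) ≤ 4εN. -/
open Set

/-- If `X` is a connected metric space, `ε > 0`, and every finite family of pairwise
disjoint open balls of radius `ε` in `X` has at most `N` members, then
`diam X ≤ 4 ε N`. -/
theorem stmt6 {X : Type*} [MetricSpace X] [ConnectedSpace X] (ε : ℝ) (hε : 0 < ε)
    (N : ℕ)
    (hpack : ∀ s : Finset X,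
      (s : Set X).PairwiseDisjoint (fun p => Metric.ball p ε) → s.card ≤ N) :
    Metric.diam (univ : Set X) ≤ 4 * ε * N := by
  classical
  apply Metric.diam_le_of_forall_dist_le (by positivity)
  intro x _ y _
  by_contra hlt
  rw [not_le] at hlt
  have key : ∀ k : Fin (N + 1), ∃ z : X, dist x z = 2 * ε * (k : ℕ) := by
    intro k
    have hk : ((k : ℕ) : ℝ) ≤ N := by exact_mod_cast Nat.lt_succ_iff.mp k.2
    have hc : Continuous (fun z : X => dist x z) := by fun_prop
    have h0 : 0 ≤ 2 * ε * ((k : ℕ) : ℝ) := by positivity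
    have h1 : 2 * ε * ((k : ℕ) : ℝ) ≤ dist x y := by
      have h2 : ε * ((k : ℕ) : ℝ) ≤ ε * N := by gcongr
      have h3 : 0 ≤ ε * (N : ℝ) := by positivity
      linarith
    exact intermediate_value_univ x y hc ⟨by simpa using h0, h1⟩
  choose z hz using key
  have hsep : ∀ i j : Fin (N + 1), i < j → ε + ε ≤ dist (z i) (z j) := by
    intro i j hij
    have h1 : ((i : ℕ) : ℝ) + 1 ≤ ((j : ℕ) : ℝ) := by exact_mod_cast hij
    have h2 := dist_triangle x (z i) (z j)
    rw [hz, hz] at h2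
    nlinarith
  have hsep2 : ∀ i j : Fin (N + 1), i ≠ j → ε + ε ≤ dist (z i) (z j) := by
    intro i j hij
    rcases lt_or_gt_of_ne hij with h | h
    · exact hsep i j h
    · rw [dist_comm]
      exact hsep j i h
  have hinj : Function.Injective z := by
    intro i j h
    by_contra hij
    have h1 := hsep2 i j hij
    rw [h, dist_self] at h1
    linarith
  have h := hpack (Finset.univ.image z) (by
    intro a ha b hb hab
    simp only [Finset.coe_image, Finset.coe_univ, image_univ, mem_range] at ha hb
    obtain ⟨i, rfl⟩ := ha
    obtain ⟨j, rfl⟩ := hb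
    exact Metric.ball_disjoint_ball (hsep2 i j (fun h => hab (by rw [h]))))
  rw [Finset.card_image_of_injective _ hinj, Finset.card_univ, Fintype.card_fin] at h
  omega
end

section
/- Let Z be a metric space, W a compact metric space, and K ≥ 0. For each i ∈ ℕ let X_i ⊆ Z be a nonempty subset and F_i : X_i → W a K-Lipschitz map (with respect to the metric X_i inherits from Z). Let X_∞ ⊆ Z be a subset that is separable (as a metric subspace) and such that every p ∈ X_∞ is the limit in Z of some sequence (p_i) with p_i ∈ X_i for all i. Then there exist a strictly increasing φ : ℕ → ℕ and a K-Lipschitz map F_∞ : X_∞ → W such that for every p ∈ X_∞ and every sequence (q_n) with q_n ∈ X_{φ(n)} and q_n → p in Z, one has F_{φ(n)}(q_n) → F_∞(p) in W. -/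
open Filter Set

/-- **Metric core of the Arzelà–Ascoli theorem for intrinsic flat convergence
(Theorem 4.25, Flat-Arz-Asc).**
Let `Z` be a metric space, `W` a compact metric space, and `K ≥ 0`.  For each `i ∈ ℕ`
let `X i ⊆ Z` be nonempty and `F i : X i → W` be `K`-Lipschitz.  Let `X∞ ⊆ Z` be a
separable subset each of whose points is a limit of a sequence of points `pᵢ ∈ X i`.
Then there are a strictly increasing `φ : ℕ → ℕ` and a `K`-Lipschitz map
`F∞ : X∞ → W` such that whenever `qₙ ∈ X (φ n)` converge in `Z` to `p ∈ X∞`, the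
images `F (φ n) qₙ` converge to `F∞ p` in `W`. -/
theorem stmt7 {Z W : Type*} [MetricSpace Z] [MetricSpace W] [CompactSpace W]
    (K : NNReal)
    (X : ℕ → Set Z) (hX : ∀ i, (X i).Nonempty)
    (F : ∀ i, X i → W) (hF : ∀ i, LipschitzWith K (F i))
    (Xinf : Set Z) (hsep : TopologicalSpace.IsSeparable Xinf)
    (hlim : ∀ p ∈ Xinf, ∃ q : ∀ i, X i,
      Tendsto (fun i => (q i : Z)) atTop (nhds p)) :
    ∃ (φ : ℕ → ℕ) (Finf : Xinf → W), StrictMono φ ∧ LipschitzWith K Finf ∧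
      ∀ (p : Xinf) (q : ∀ n, X (φ n)),
        Tendsto (fun n => (q n : Z)) atTop (nhds (p : Z)) →
        Tendsto (fun n => F (φ n) (q n)) atTop (nhds (Finf p)) := by
  choose Q hQ using fun p : Xinf => hlim p p.2
  have hsp : TopologicalSpace.SeparableSpace Xinf := hsep.separableSpace
  obtain ⟨D, hDc, hDd⟩ := TopologicalSpace.exists_countable_dense Xinf
  have : Countable D := hDc.to_subtype
  obtain ⟨g, φ, hφ, hg⟩ := CompactSpace.tendsto_subseq
    (fun i => (fun d : D => F i (Q d.1 i)) : ℕ → D → W)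
  rw [tendsto_pi_nhds] at hg
  have hQφ : ∀ p : Xinf, Tendsto (fun n => (Q p (φ n) : Z)) atTop (nhds (p : Z)) :=
    fun p => (hQ p).comp hφ.tendsto_atTop
  have hFd : ∀ i (a b : X i), dist (F i a) (F i b) ≤ K * dist (a : Z) (b : Z) :=
    fun i a b => (hF i).dist_le_mul a b
  have hpd : ∀ p r : Xinf, Tendsto (fun n => (K : ℝ) * dist (Q p (φ n) : Z) (Q r (φ n) : Z))
      atTop (nhds (K * dist (p : Z) (r : Z))) :=
    fun p r => ((hQφ p).dist (hQφ r)).const_mul _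
  have hcauchy : ∀ p : Xinf, CauchySeq (fun n => F (φ n) (Q p (φ n))) := by
    intro p
    rw [Metric.cauchySeq_iff]
    intro ε hε
    have hK : (0 : ℝ) < K + 1 := by positivity
    obtain ⟨d, hdD, hd⟩ := hDd.exists_dist_lt p (ε := ε / 4 / (K + 1)) (by positivity)
    have hd1 : (K : ℝ) * dist (p : Z) (d : Z) < ε / 4 := by
      have h1 : dist (p : Z) (d : Z) * (K + 1) < ε / 4 := (lt_div_iff₀ hK).1 hd
      have h2 : 0 ≤ dist (p : Z) (d : Z) := dist_nonneg
      nlinarith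
    have e1 := (hpd p d).eventually_lt_const hd1
    have hgd : CauchySeq (fun n => F (φ n) (Q d (φ n))) := (hg ⟨d, hdD⟩).cauchySeq
    obtain ⟨N1, hN1⟩ := eventually_atTop.1 e1
    obtain ⟨N2, hN2⟩ := Metric.cauchySeq_iff.1 hgd (ε / 4) (by positivity)
    refine ⟨max N1 N2, fun m hm n hn => ?_⟩
    have a1 := (hFd _ (Q p (φ m)) (Q d (φ m))).trans_lt (hN1 m (le_of_max_le_left hm))
    have a2 := (hFd _ (Q p (φ n)) (Q d (φ n))).trans_lt (hN1 n (le_of_max_le_left hn))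
    have a3 := hN2 m (le_of_max_le_right hm) n (le_of_max_le_right hn)
    have a4 := dist_triangle4 (F (φ m) (Q p (φ m))) (F (φ m) (Q d (φ m)))
      (F (φ n) (Q d (φ n))) (F (φ n) (Q p (φ n)))
    rw [dist_comm (F (φ n) (Q d (φ n))) (F (φ n) (Q p (φ n)))] at a4
    linarith
  choose Finf hFinf using fun p => cauchySeq_tendsto_of_complete (hcauchy p)
  refine ⟨φ, Finf, hφ, ?_, ?_⟩
  · refine LipschitzWith.of_dist_le_mul fun p r => ?_
    exact le_of_tendsto_of_tendsto' ((hFinf p).dist (hFinf r)) (hpd p r) fun n => hFd _ _ _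
  · intro p q hq
    refine (tendsto_iff_of_dist ?_).1 (hFinf p)
    have h0 : Tendsto (fun n => (K : ℝ) * dist (Q p (φ n) : Z) (q n : Z)) atTop (nhds 0) := by
      simpa using ((hQφ p).dist hq).const_mul (K : ℝ)
    exact squeeze_zero (fun _ => dist_nonneg) (fun n => hFd _ _ _) h0
end
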